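/- arXiv:1203.1422 — 2 statements merged into one kernel-verified Lean document; each statement's English description precedes it below -/
import Mathlib

section
/- Fractional Cauchy–Lipschitz theorem (integral form): let a < b be reals, d a positive integer, 0 < α ≤ 1, A ∈ ℝ^d, and F : ℝ^d × [a,b] → ℝ^d continuous and satisfying the Lipschitz condition: there exists K ≥ 0 with ‖F(x₁,t) - F(x₂,t)‖ ≤ K‖x₁ - x₂‖ for all x₁, x₂ ∈ ℝ^d and t ∈ [a,b]. Then there exists a unique continuous function g : [a,b] → ℝ^d such that g(t) = A + I^α_-(s ↦ F(g(s),s))(t) for all t ∈ [a,b] (equivalently, g is the unique continuous solution of the Caputo fractional Cauchy problem ᶜD^α_- g = F(g,t), g(a) = A). -/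
open Set Filter Topology MeasureTheory RealInnerProductSpace

/-- Left Riemann–Liouville fractional integral of order `α` with inferior limit `a`.
(At `t = a` the integral vanishes, so `Ileft a α g a = 0`.) -/
noncomputable def Ileft {E : Type*} [NormedAddCommGroup E] [NormedSpace ℝ E]
    (a α : ℝ) (g : ℝ → E) (t : ℝ) : E :=
  (Real.Gamma α)⁻¹ • ∫ y in a..t, (t - y) ^ (α - 1) • g y

/-- Right Riemann–Liouville fractional integral of order `α` with superior limit `b`.
(At `t = b` the integral vanishes, so `Iright b α g b = 0`.) -/
noncomputable def Iright {E : Type*} [NormedAddCommGroup E] [NormedSpace ℝ E]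
    (b α : ℝ) (g : ℝ → E) (t : ℝ) : E :=
  (Real.Gamma α)⁻¹ • ∫ y in t..b, (y - t) ^ (α - 1) • g y

theorem intervalIntegrable_sub_rpow_smul {E : Type*} [NormedAddCommGroup E] [NormedSpace ℝ E]
    {a t α : ℝ} (hα : 0 < α) (hat : a ≤ t) {g : ℝ → E} (hg : ContinuousOn g (Icc a t)) :
    IntervalIntegrable (fun y => (t - y) ^ (α - 1) • g y) volume a t := by
  have h : IntervalIntegrable (fun y : ℝ => (t - y) ^ (α - 1)) volume a t := by
    simpa using ((intervalIntegral.intervalIntegrable_rpow' (a := t - a) (b := 0)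
      (r := α - 1) (by linarith)).comp_sub_left t)
  exact h.smul_continuousOn (by rwa [uIcc_of_le hat])

theorem Ileft_congr {E : Type*} [NormedAddCommGroup E] [NormedSpace ℝ E]
    {a t α : ℝ} (hat : a ≤ t) {g₁ g₂ : ℝ → E} (h : EqOn g₁ g₂ (Icc a t)) :
    Ileft a α g₁ t = Ileft a α g₂ t := by
  unfold Ileft
  congr 1
  refine intervalIntegral.integral_congr fun y hy => ?_
  rw [uIcc_of_le hat] at hy
  simp only [h hy]

theorem Ileft_eq_integral_zero_one {E : Type*} [NormedAddCommGroup E] [NormedSpace ℝ E]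
    {a t α : ℝ} (hα : 0 < α) (hat : a ≤ t) (g : ℝ → E) :
    Ileft a α g t = (Real.Gamma α)⁻¹ •
      ((t - a) ^ α • ∫ v in (0 : ℝ)..1, (1 - v) ^ (α - 1) • g (a + (t - a) * v)) := by
  rcases hat.eq_or_lt with rfl | hlt
  · simp [Ileft, Real.zero_rpow hα.ne']
  have hpos : 0 < t - a := sub_pos.2 hlt
  unfold Ileft
  congr 1
  have hsub := intervalIntegral.smul_integral_comp_add_mul
    (f := fun y => (t - y) ^ (α - 1) • g y) (a := 0) (b := 1) (t - a) a
  rw [show a + (t - a) * 0 = a by ring, show a + (t - a) * 1 = t by ring] at hsub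
  rw [← hsub, ← intervalIntegral.integral_smul, ← intervalIntegral.integral_smul]
  refine intervalIntegral.integral_congr fun v hv => ?_
  rw [uIcc_of_le zero_le_one] at hv
  simp only [smul_smul]
  congr 1
  rw [show t - (a + (t - a) * v) = (t - a) * (1 - v) by ring,
    Real.mul_rpow hpos.le (sub_nonneg.2 hv.2), ← mul_assoc, ← Real.rpow_one_add' hpos.le]
  · ring_nf
  · simpa using hα.ne'

theorem continuousOn_Ileft {E : Type*} [NormedAddCommGroup E] [NormedSpace ℝ E]
    {a b α : ℝ} (hα : 0 < α) (hab : a ≤ b) {g : ℝ → E} (hg : ContinuousOn g (Icc a b)) :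
    ContinuousOn (Ileft a α g) (Icc a b) := by
  set G : ℝ → E := IccExtend hab ((Icc a b).domRestrict g) with hG
  have hGc : Continuous G := hg.domRestrict.Icc_extend'
  have hEq : EqOn g G (Icc a b) := fun x hx => by simp [hG, IccExtend_of_mem, hx]
  obtain ⟨C, hC⟩ := isCompact_Icc.exists_bound_of_continuousOn hg
  have hGb : ∀ x, ‖G x‖ ≤ C := fun x => hC _ (projIcc a b hab x).2
  have hcont : Continuous fun t : ℝ => (Real.Gamma α)⁻¹ •
      ((t - a) ^ α • ∫ v in (0 : ℝ)..1, (1 - v) ^ (α - 1) • G (a + (t - a) * v)) := by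
    refine continuous_const.smul (Continuous.smul
      ((continuous_id.sub continuous_const).rpow_const fun _ => Or.inr hα.le) ?_)
    refine intervalIntegral.continuous_of_dominated_interval
      (bound := fun v => (1 - v) ^ (α - 1) • C) ?_ ?_ ?_ ?_
    · intro t
      have hGt : Continuous fun v => G (a + (t - a) * v) := by fun_prop
      have hint := intervalIntegrable_sub_rpow_smul hα zero_le_one hGt.continuousOn
      exact (intervalIntegrable_iff.1 hint).aestronglyMeasurable
    · intro t
      refine ae_of_all _ fun v hv => ?_
      rw [uIoc_of_le zero_le_one] at hv
      have h1 : 0 ≤ (1 - v) ^ (α - 1) := Real.rpow_nonneg (sub_nonneg.2 hv.2) _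
      rw [norm_smul, Real.norm_of_nonneg h1, smul_eq_mul]
      exact mul_le_mul_of_nonneg_left (hGb _) h1
    · exact intervalIntegrable_sub_rpow_smul hα zero_le_one continuousOn_const
    · exact ae_of_all _ fun v _ => by fun_prop
  refine hcont.continuousOn.congr fun t ht => ?_
  rw [Ileft_congr ht.1 (hEq.mono (Icc_subset_Icc_right ht.2)), Ileft_eq_integral_zero_one hα ht.1]

theorem integral_sub_rpow_mul_exp_le {a t α θ : ℝ} (hα : 0 < α) (hθ : 0 < θ) (hat : a ≤ t) :
    ∫ y in a..t, (t - y) ^ (α - 1) * Real.exp (θ * (y - a)) ≤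
      Real.exp (θ * (t - a)) * ((1 / θ) ^ α * Real.Gamma α) := by
  have hval := Real.integral_rpow_mul_exp_neg_mul_Ioi hα hθ
  have hint : IntegrableOn (fun u : ℝ => u ^ (α - 1) * Real.exp (-(θ * u))) (Ioi 0) := by
    by_contra h
    rw [integral_undef h] at hval
    have := Real.Gamma_pos_of_pos hα
    have : 0 < (1 / θ) ^ α * Real.Gamma α := by positivity
    exact this.ne hval
  calc ∫ y in a..t, (t - y) ^ (α - 1) * Real.exp (θ * (y - a))
      = ∫ y in a..t, Real.exp (θ * (t - a)) *
          ((t - y) ^ (α - 1) * Real.exp (-(θ * (t - y)))) := by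
        refine intervalIntegral.integral_congr fun y _ => ?_
        rw [mul_left_comm, ← Real.exp_add]
        ring_nf
    _ = Real.exp (θ * (t - a)) *
          ∫ u in (0 : ℝ)..(t - a), u ^ (α - 1) * Real.exp (-(θ * u)) := by
        rw [intervalIntegral.integral_const_mul, intervalIntegral.integral_comp_sub_left
          (fun u : ℝ => u ^ (α - 1) * Real.exp (-(θ * u))) t, sub_self]
    _ ≤ _ := by
        rw [← hval, intervalIntegral.integral_of_le (sub_nonneg.2 hat)]
        refine mul_le_mul_of_nonneg_left ?_ (Real.exp_pos _).le
        refine setIntegral_mono_set hint ?_ Ioc_subset_Ioi_self.eventuallyLE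
        filter_upwards [ae_restrict_mem measurableSet_Ioi] with u hu
        have hu' : (0 : ℝ) < u := hu
        simp only [Pi.zero_apply]
        positivity

theorem norm_Ileft_sub_Ileft_le {E : Type*} [NormedAddCommGroup E] [NormedSpace ℝ E]
    {a t α θ C : ℝ} (hα : 0 < α) (hθ : 0 < θ) (hC : 0 ≤ C) (hat : a ≤ t) {g₁ g₂ : ℝ → E}
    (h₁ : ContinuousOn g₁ (Icc a t)) (h₂ : ContinuousOn g₂ (Icc a t))
    (h : ∀ s ∈ Icc a t, ‖g₁ s - g₂ s‖ ≤ C * Real.exp (θ * (s - a))) :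
    ‖Ileft a α g₁ t - Ileft a α g₂ t‖ ≤ C * (1 / θ) ^ α * Real.exp (θ * (t - a)) := by
  have hΓ := Real.Gamma_pos_of_pos hα
  unfold Ileft
  rw [← smul_sub, ← intervalIntegral.integral_sub (intervalIntegrable_sub_rpow_smul hα hat h₁)
    (intervalIntegrable_sub_rpow_smul hα hat h₂), norm_smul,
    Real.norm_of_nonneg (inv_nonneg.2 hΓ.le), inv_mul_le_iff₀ hΓ]
  have hb : IntervalIntegrable (fun y => C * ((t - y) ^ (α - 1) * Real.exp (θ * (y - a))))
      volume a t :=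
    (intervalIntegrable_sub_rpow_smul (E := ℝ) (g := fun y => Real.exp (θ * (y - a))) hα hat
      (by fun_prop)).const_mul C
  refine (intervalIntegral.norm_integral_le_of_norm_le hat (ae_of_all _ fun y hy => ?_) hb).trans ?_
  · have h0 : 0 ≤ (t - y) ^ (α - 1) := Real.rpow_nonneg (sub_nonneg.2 hy.2) _
    rw [← smul_sub, norm_smul, Real.norm_of_nonneg h0, mul_left_comm]
    exact mul_le_mul_of_nonneg_left (h y (Ioc_subset_Icc_self hy)) h0
  · rw [intervalIntegral.integral_const_mul]
    refine (mul_le_mul_of_nonneg_left (integral_sub_rpow_mul_exp_le hα hθ hat) hC).trans_eq ?_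
    ring

theorem exists_pos_mul_one_div_rpow_le_half {α K : ℝ} (hα : 0 < α) (hK : 0 ≤ K) :
    ∃ θ : ℝ, 0 < θ ∧ K * (1 / θ) ^ α ≤ 1 / 2 := by
  have h : 0 < 2 * K + 1 := by positivity
  refine ⟨(2 * K + 1) ^ (1 / α), by positivity, ?_⟩
  rw [Real.div_rpow zero_le_one (by positivity), ← Real.rpow_mul h.le, one_div_mul_cancel hα.ne',
    Real.rpow_one, Real.one_rpow, mul_one_div, div_le_div_iff₀ h two_pos]
  linarith

/-- Fractional Cauchy–Lipschitz theorem (integral form): existence and uniqueness of a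
continuous solution of the Caputo fractional Cauchy problem `ᶜD^α_- g = F(g,t)`, `g(a) = A`. -/
theorem fractional_cauchy_lipschitz
    (a b : ℝ) (hab : a < b) (d : ℕ) (hd : 0 < d) (α : ℝ) (hα0 : 0 < α) (hα1 : α ≤ 1)
    (A : EuclideanSpace ℝ (Fin d))
    (F : EuclideanSpace ℝ (Fin d) → ℝ → EuclideanSpace ℝ (Fin d))
    (hF : ContinuousOn (fun p : EuclideanSpace ℝ (Fin d) × ℝ => F p.1 p.2)
      (univ ×ˢ Icc a b))
    (K : ℝ) (hK : 0 ≤ K)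
    (hlip : ∀ x₁ x₂ : EuclideanSpace ℝ (Fin d), ∀ t ∈ Icc a b,
      ‖F x₁ t - F x₂ t‖ ≤ K * ‖x₁ - x₂‖) :
    ∃ g : ℝ → EuclideanSpace ℝ (Fin d),
      (ContinuousOn g (Icc a b) ∧
        ∀ t ∈ Icc a b, g t = A + Ileft a α (fun s => F (g s) s) t) ∧
      ∀ g₂ : ℝ → EuclideanSpace ℝ (Fin d), ContinuousOn g₂ (Icc a b) →
        (∀ t ∈ Icc a b, g₂ t = A + Ileft a α (fun s => F (g₂ s) s) t) →
        ∀ t ∈ Icc a b, g₂ t = g t := by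
  obtain ⟨θ, hθ, hθK⟩ := exists_pos_mul_one_div_rpow_le_half hα0 hK
  have hcomp : ∀ g : ℝ → EuclideanSpace ℝ (Fin d), ContinuousOn g (Icc a b) →
      ContinuousOn (fun s => F (g s) s) (Icc a b) := fun g hg =>
    hF.comp (hg.prodMk continuousOn_id) fun s hs => ⟨mem_univ _, hs⟩
  let w : C(Icc a b, EuclideanSpace ℝ (Fin d)) → ℝ → EuclideanSpace ℝ (Fin d) :=
    fun φ s => Real.exp (θ * (s - a)) • IccExtend hab.le φ s
  have hw : ∀ φ, Continuous (w φ) := fun φ => by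
    have := φ.continuous.Icc_extend' (h := hab.le)
    fun_prop
  have hwF : ∀ φ, ContinuousOn (fun s => F (w φ s) s) (Icc a b) := fun φ =>
    hcomp _ (hw φ).continuousOn
  let T : C(Icc a b, EuclideanSpace ℝ (Fin d)) → C(Icc a b, EuclideanSpace ℝ (Fin d)) := fun φ =>
    ⟨fun t => Real.exp (-(θ * (t - a))) • (A + Ileft a α (fun s => F (w φ s) s) t), by
      have : Continuous fun t : Icc a b => Ileft a α (fun s => F (w φ s) s) t :=
        (continuousOn_Ileft hα0 hab.le (hwF φ)).domRestrict
      fun_prop⟩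
  have hT : ContractingWith (1 / 2) T := by
    refine ⟨by norm_num, LipschitzWith.of_dist_le_mul fun φ ψ => ?_⟩
    rw [ContinuousMap.dist_le (by positivity)]
    rintro ⟨t, ht⟩
    have hsub : Icc a t ⊆ Icc a b := Icc_subset_Icc_right ht.2
    have key := norm_Ileft_sub_Ileft_le (C := K * dist φ ψ) hα0 hθ (by positivity) ht.1
      ((hwF φ).mono hsub) ((hwF ψ).mono hsub) fun s hs => by
        refine (hlip _ _ s (hsub hs)).trans ?_
        rw [mul_assoc, mul_comm (dist φ ψ), ← smul_sub, norm_smul, Real.norm_of_nonneg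
          (Real.exp_pos _).le, ← dist_eq_norm]
        gcongr
        exact ContinuousMap.dist_apply_le_dist _
    simp only [T, ContinuousMap.coe_mk]
    rw [dist_eq_norm, ← smul_sub, add_sub_add_left_eq_sub, norm_smul, Real.norm_of_nonneg
      (Real.exp_pos _).le, Real.exp_neg, inv_mul_le_iff₀ (Real.exp_pos _), mul_comm]
    refine key.trans ?_
    refine mul_le_mul_of_nonneg_right ?_ (Real.exp_pos _).le
    calc K * dist φ ψ * (1 / θ) ^ α = K * (1 / θ) ^ α * dist φ ψ := by ring
      _ ≤ 1 / 2 * dist φ ψ := mul_le_mul_of_nonneg_right hθK dist_nonneg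
      _ = _ := by norm_num
  have hmul : ∀ (t : ℝ) (x : EuclideanSpace ℝ (Fin d)),
      Real.exp (θ * (t - a)) • Real.exp (-(θ * (t - a))) • x = x := fun t x => by
    rw [smul_smul, ← Real.exp_add, add_neg_cancel, Real.exp_zero, one_smul]
  obtain ⟨φ, hφ⟩ : ∃ φ, T φ = φ := ⟨_, hT.fixedPoint_isFixedPt⟩
  refine ⟨w φ, ⟨(hw φ).continuousOn, fun t ht => ?_⟩, fun g₂ hg₂ h₂ t ht => ?_⟩
  · calc w φ t = Real.exp (θ * (t - a)) • T φ ⟨t, ht⟩ := by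
          rw [hφ]; simp only [w, IccExtend_of_mem hab.le φ ht]
      _ = _ := hmul t _
  · have hg₂c : Continuous fun t : Icc a b => g₂ t := hg₂.domRestrict
    have hexp : Continuous fun t : Icc a b => Real.exp (-(θ * ((t : ℝ) - a))) := by fun_prop
    let ψ : C(Icc a b, EuclideanSpace ℝ (Fin d)) :=
      ⟨fun t => Real.exp (-(θ * (t - a))) • g₂ t, hexp.smul hg₂c⟩
    have hψ : EqOn (w ψ) g₂ (Icc a b) := fun s hs => by
      simp only [w, IccExtend_of_mem hab.le ψ hs]
      exact hmul s _
    have hfix : T ψ = ψ := by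
      ext1 ⟨s, hs⟩
      simp only [T, ψ, ContinuousMap.coe_mk]
      rw [h₂ s hs]
      congr 2
      exact Ileft_congr hs.1 fun y hy =>
        congrArg (F · y) (hψ (Icc_subset_Icc_right hs.2 hy))
    rw [← hψ ht, hT.fixedPoint_unique' hfix hφ]
end

section
/- Fractional Gronwall lemma: let a < b be reals, α > 0, g : [a,b] → ℝ continuous, and K₁, K₂ ≥ 0 such that 0 ≤ g(t) ≤ K₁ · I^α_- g(t) + K₂ for all t ∈ [a,b]. Then 0 ≤ g(t) ≤ K₂ · E_{α,1}(K₁ (t-a)^α) for all t ∈ [a,b]. -/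
open Set Filter Topology MeasureTheory RealInnerProductSpace

/-- The Mittag-Leffler function `E_{α₁,α₂}(t) = Σ_{k=0}^∞ t^k / Γ(α₁ k + α₂)`. -/
noncomputable def mittagLeffler (α₁ α₂ t : ℝ) : ℝ :=
  ∑' k : ℕ, t ^ k / Real.Gamma (α₁ * k + α₂)

/-- The Beta integral over `[a, t]`. -/
lemma integral_sub_rpow_mul_sub_rpow {a t α β : ℝ} (hat : a ≤ t) (hα : 0 < α) (hβ : 0 ≤ β) :
    ∫ y in a..t, (t - y) ^ (α - 1) * (y - a) ^ β =
      Real.Gamma α * Real.Gamma (β + 1) / Real.Gamma (β + α + 1) * (t - a) ^ (β + α) := by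
  rcases hat.eq_or_lt with rfl | hlt
  · simp [Real.zero_rpow (by positivity : β + α ≠ 0)]
  have hc : 0 < t - a := sub_pos.2 hlt
  have hshift : ∫ y in a..t, (t - y) ^ (α - 1) * (y - a) ^ β =
      ∫ x in (0 : ℝ)..(t - a), x ^ β * (t - a - x) ^ (α - 1) := by
    have h := intervalIntegral.integral_comp_sub_right
      (fun x : ℝ => x ^ β * (t - a - x) ^ (α - 1)) a (a := a) (b := t)
    rw [sub_self] at h
    rw [← h]
    refine intervalIntegral.integral_congr fun y _ => ?_
    simp only [sub_sub_sub_cancel_right]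
    ring
  have hbeta := Complex.betaIntegral_scaled ((β + 1 : ℝ) : ℂ) (α : ℂ) hc
  rw [Complex.betaIntegral_eq_Gamma_mul_div _ _ (by rw [Complex.ofReal_re]; linarith) (by simpa),
    ← Complex.ofReal_add, Complex.Gamma_ofReal, Complex.Gamma_ofReal, Complex.Gamma_ofReal] at hbeta
  have hint : ∫ x in (0 : ℝ)..(t - a),
      (x : ℂ) ^ (((β + 1 : ℝ) : ℂ) - 1) * (((t - a : ℝ) : ℂ) - x) ^ ((α : ℂ) - 1) =
      ((∫ x in (0 : ℝ)..(t - a), x ^ β * (t - a - x) ^ (α - 1) : ℝ) : ℂ) := by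
    rw [← intervalIntegral.integral_ofReal]
    refine intervalIntegral.integral_congr fun x hx => ?_
    rw [uIcc_of_le hc.le] at hx
    have h1 : ((β + 1 : ℝ) : ℂ) - 1 = (β : ℂ) := by push_cast; ring
    simp only [h1]
    rw [Complex.ofReal_mul, Complex.ofReal_cpow hx.1, Complex.ofReal_cpow (sub_nonneg.2 hx.2)]
    push_cast
    rfl
  have hpow : ((t - a : ℝ) : ℂ) ^ (((β + 1 + α : ℝ) : ℂ) - 1) = (((t - a) ^ (β + α) : ℝ) : ℂ) := by
    rw [Complex.ofReal_cpow hc.le]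
    congr 1
    push_cast
    ring
  rw [hint, hpow] at hbeta
  rw [hshift, show β + α + 1 = β + 1 + α by ring, mul_comm (_ / _), mul_comm (Real.Gamma α)]
  exact_mod_cast hbeta

/-- The singular kernel of the fractional integral times a continuous function is integrable. -/
lemma intervalIntegrable_sub_rpow_mul {a t α : ℝ} (hat : a ≤ t) (hα : 0 < α) {f : ℝ → ℝ}
    (hf : ContinuousOn f (Icc a t)) :
    IntervalIntegrable (fun y => (t - y) ^ (α - 1) * f y) volume a t := by
  have h : IntervalIntegrable (fun y : ℝ => (t - y) ^ (α - 1)) volume a t := by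
    have := (intervalIntegral.intervalIntegrable_rpow' (a := t - a) (b := 0)
      (by linarith : -1 < α - 1)).comp_sub_left t
    simpa using this
  exact h.mul_continuousOn (by rwa [uIcc_of_le hat])

lemma Ileft_mono {a t α : ℝ} (hat : a ≤ t) (hα : 0 < α) {f g : ℝ → ℝ}
    (hf : ContinuousOn f (Icc a t)) (hg : ContinuousOn g (Icc a t))
    (hfg : ∀ y ∈ Icc a t, f y ≤ g y) : Ileft a α f t ≤ Ileft a α g t := by
  simp only [Ileft, smul_eq_mul]
  have hΓ := Real.Gamma_pos_of_pos hα
  gcongr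
  refine intervalIntegral.integral_mono_on hat (intervalIntegrable_sub_rpow_mul hat hα hf)
    (intervalIntegrable_sub_rpow_mul hat hα hg) fun y hy => ?_
  exact mul_le_mul_of_nonneg_left (hfg y hy) (Real.rpow_nonneg (sub_nonneg.2 hy.2) _)

lemma continuous_sub_rpow_const {a β : ℝ} (hβ : 0 ≤ β) : Continuous fun y : ℝ => (y - a) ^ β :=
  (continuous_id.sub continuous_const).rpow_const fun _ => Or.inr hβ

/-- The fractional integral of a generalized polynomial in powers of `(y - a) ^ α`. -/
lemma Ileft_sum_rpow {a t α : ℝ} (hat : a ≤ t) (hα : 0 < α) (s : Finset ℕ) (c : ℕ → ℝ) :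
    Ileft a α (fun y => ∑ k ∈ s, c k * ((y - a) ^ (α * k) / Real.Gamma (α * k + 1))) t =
      ∑ k ∈ s, c k * ((t - a) ^ (α * (k + 1 : ℕ)) / Real.Gamma (α * (k + 1 : ℕ) + 1)) := by
  have hβ (k : ℕ) : 0 ≤ α * k := by positivity
  simp only [Ileft, smul_eq_mul, Finset.mul_sum]
  rw [intervalIntegral.integral_finsetSum fun k _ =>
    intervalIntegrable_sub_rpow_mul hat hα
      (((continuous_sub_rpow_const (hβ k)).div_const _).const_mul _).continuousOn, Finset.mul_sum]
  refine Finset.sum_congr rfl fun k _ => ?_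
  have hΓα := (Real.Gamma_pos_of_pos hα).ne'
  have hΓβ := (Real.Gamma_pos_of_pos (by linarith [hβ k] : 0 < α * k + 1)).ne'
  have hfactor : ∀ y : ℝ, (t - y) ^ (α - 1) * (c k * ((y - a) ^ (α * k) / Real.Gamma (α * k + 1))) =
      c k / Real.Gamma (α * k + 1) * ((t - y) ^ (α - 1) * (y - a) ^ (α * k)) := fun y => by ring
  simp only [hfactor]
  rw [intervalIntegral.integral_const_mul, integral_sub_rpow_mul_sub_rpow hat hα (hβ k),
    show α * (k + 1 : ℕ) = α * k + α by push_cast; ring]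
  field_simp

lemma rpow_mul_exp_neg_le_Gamma {A s : ℝ} (hA : 0 < A) (hs : 1 ≤ s) :
    A ^ (s - 1) * Real.exp (-A) ≤ Real.Gamma s := by
  rw [Real.Gamma_eq_integral (by linarith), ← integral_exp_neg_Ioi A, ← integral_const_mul]
  have hint := Real.GammaIntegral_convergent (by linarith : 0 < s)
  have hsub : Ioi A ⊆ Ioi (0 : ℝ) := Ioi_subset_Ioi hA.le
  calc ∫ x in Ioi A, A ^ (s - 1) * Real.exp (-x)
      ≤ ∫ x in Ioi A, Real.exp (-x) * x ^ (s - 1) := by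
        refine setIntegral_mono_on ((integrableOn_exp_neg_Ioi A).const_mul _) (hint.mono_set hsub)
          measurableSet_Ioi fun x hx => ?_
        rw [mul_comm]
        exact mul_le_mul_of_nonneg_left
          (Real.rpow_le_rpow hA.le (mem_Ioi.1 hx).le (by linarith)) (Real.exp_pos _).le
    _ ≤ ∫ x in Ioi (0 : ℝ), Real.exp (-x) * x ^ (s - 1) := by
        refine setIntegral_mono_set hint ?_ (Eventually.of_forall hsub)
        filter_upwards [ae_restrict_mem measurableSet_Ioi] with x hx
        exact mul_nonneg (Real.exp_pos _).le (Real.rpow_nonneg (mem_Ioi.1 hx).le _)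

lemma summable_mittagLeffler {α x : ℝ} (hα : 0 < α) (hx : 0 ≤ x) :
    Summable fun k : ℕ => x ^ k / Real.Gamma (α * k + 1) := by
  set A : ℝ := (x + 1) ^ α⁻¹ with hAdef
  have hA : 0 < A := by positivity
  have hAα : A ^ α = x + 1 := Real.rpow_inv_rpow (by positivity) hα.ne'
  have hgeom : Summable fun k : ℕ => Real.exp A * (x / (x + 1)) ^ k :=
    (summable_geometric_of_lt_one (by positivity)
      ((div_lt_one (by positivity)).2 (by linarith))).mul_left _
  refine hgeom.of_nonneg_of_le (fun k => ?_) fun k => ?_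
  · exact div_nonneg (by positivity) (Real.Gamma_pos_of_pos (by positivity)).le
  · have hk : (0 : ℝ) ≤ α * k := by positivity
    have h := rpow_mul_exp_neg_le_Gamma hA (by linarith : 1 ≤ α * k + 1)
    rw [add_sub_cancel_right, Real.rpow_mul hA.le, hAα, Real.rpow_natCast] at h
    calc x ^ k / Real.Gamma (α * k + 1) ≤ x ^ k / ((x + 1) ^ k * Real.exp (-A)) := by gcongr
      _ = Real.exp A * (x / (x + 1)) ^ k := by
        rw [Real.exp_neg, div_pow]
        field_simp

/-- Iterating the integral inequality `n` times from the bound `g ≤ M`. -/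
lemma le_sum_of_le_Ileft {a b α K₁ K₂ M : ℝ} (hα : 0 < α) {g : ℝ → ℝ}
    (hg : ContinuousOn g (Icc a b)) (hK₁ : 0 ≤ K₁)
    (hbound : ∀ t ∈ Icc a b, g t ≤ K₁ * Ileft a α g t + K₂) (hM : ∀ t ∈ Icc a b, g t ≤ M)
    (n : ℕ) : ∀ t ∈ Icc a b, g t ≤ ∑ k ∈ Finset.range (n + 1),
      (K₁ ^ k * if k < n then K₂ else M) * ((t - a) ^ (α * k) / Real.Gamma (α * k + 1)) := by
  induction n with
  | zero => simpa using hM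
  | succ n ih =>
    intro t ht
    have hsub : Icc a t ⊆ Icc a b := Icc_subset_Icc_right ht.2
    have hle := Ileft_mono ht.1 hα (hg.mono hsub)
      (Continuous.continuousOn (continuous_finsetSum _ fun k _ =>
        ((continuous_sub_rpow_const (by positivity)).div_const _).const_mul _))
      fun y hy => ih y (hsub hy)
    rw [Ileft_sum_rpow ht.1 hα] at hle
    refine (hbound t ht).trans ((add_le_add_left (mul_le_mul_of_nonneg_left hle hK₁) K₂).trans_eq ?_)
    rw [Finset.sum_range_succ' _ (n + 1), Finset.mul_sum]
    congr 1
    · refine Finset.sum_congr rfl fun k _ => ?_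
      simp only [add_lt_add_iff_right, pow_succ]
      ring
    · simp

/-- Fractional Gronwall lemma. -/
theorem fractional_gronwall
    (a b : ℝ) (hab : a < b) (α : ℝ) (hα : 0 < α)
    (g : ℝ → ℝ) (hg : ContinuousOn g (Icc a b))
    (K₁ K₂ : ℝ) (hK₁ : 0 ≤ K₁) (hK₂ : 0 ≤ K₂)
    (hbound : ∀ t ∈ Icc a b, 0 ≤ g t ∧ g t ≤ K₁ * Ileft a α g t + K₂) :
    ∀ t ∈ Icc a b, 0 ≤ g t ∧ g t ≤ K₂ * mittagLeffler α 1 (K₁ * (t - a) ^ α) := by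
  intro t ht
  refine ⟨(hbound t ht).1, ?_⟩
  obtain ⟨M, hM⟩ := isCompact_Icc.bddAbove_image hg
  have hiter := le_sum_of_le_Ileft (K₂ := K₂) (M := M) hα hg hK₁ (fun s hs => (hbound s hs).2)
    fun s hs => hM (mem_image_of_mem g hs)
  have hta : 0 ≤ t - a := sub_nonneg.2 ht.1
  have hsum := summable_mittagLeffler hα (mul_nonneg hK₁ (Real.rpow_nonneg hta α))
  have hterm (k : ℕ) : (K₁ * (t - a) ^ α) ^ k / Real.Gamma (α * k + 1) =
      K₁ ^ k * ((t - a) ^ (α * k) / Real.Gamma (α * k + 1)) := by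
    rw [mul_pow, Real.rpow_mul hta, Real.rpow_natCast, mul_div_assoc]
  have hlim := (hsum.hasSum.tendsto_sum_nat.const_mul K₂).add (hsum.tendsto_atTop_zero.const_mul M)
  rw [mul_zero, add_zero] at hlim
  refine ge_of_tendsto' hlim fun n => (hiter n t ht).trans_eq ?_
  rw [Finset.sum_range_succ, Finset.mul_sum]
  congr 1
  · refine Finset.sum_congr rfl fun k hk => ?_
    rw [if_pos (Finset.mem_range.1 hk), hterm]
    ring
  · rw [if_neg (lt_irrefl n), hterm]
    ring
end
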